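/- arXiv:1506.00814 — 2 statements merged into one kernel-verified Lean document; each statement's English description precedes it below -/
import Mathlib

section
/- Let T be an interval exchange transformation with no connections, and let x ∈ X be a point whose forward orbit is infinite and non-periodic. Then for every open interval I ⊂ ℝ having x as an endpoint, the forward orbit of x returns to I: there exists n ≥ 1 such that T^i(x) is defined for all 1 ≤ i ≤ n and T^n(x) ∈ I. -/
open Set Topology MeasureTheory

/-- A set `S` is *admissible* for `T` if it is closed and discrete and `T`
restricted to the complement of `S` is a homeomorphism onto the complement of a
closed discrete set. -/
def Admissible {X : Type*} [TopologicalSpace X] (T : X → X) (S : Set X) : Prop :=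
  IsClosed S ∧ DiscreteTopology ↥S ∧
    ∃ S' : Set X, IsClosed S' ∧ DiscreteTopology ↥S' ∧
      ∃ h : ↥(Sᶜ) ≃ₜ ↥(S'ᶜ), ∀ x : ↥(Sᶜ), (h x : X) = T (x : X)

/-- The set of singularities of `T`: the minimal admissible set. -/
def Sing {X : Type*} [TopologicalSpace X] (T : X → X) : Set X :=
  ⋂₀ {S | Admissible T S}

/-- The image of a set, never applying `T` at singular points. -/
def img {X : Type*} [TopologicalSpace X] (T : X → X) (A : Set X) : Set X :=
  T '' (A \ Sing T)

/-- The preimage of a set under `T`, i.e. the image under `T⁻¹`. -/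
def preimg {X : Type*} [TopologicalSpace X] (T : X → X) (A : Set X) : Set X :=
  {y | y ∉ Sing T ∧ T y ∈ A}

/-- The iterated image `T^k(A)`, `k ∈ ℤ`. -/
def iterImg {X : Type*} [TopologicalSpace X] (T : X → X) (k : ℤ) (A : Set X) : Set X :=
  if 0 ≤ k then (img T)^[k.toNat] A else (preimg T)^[(-k).toNat] A

/-- The forward orbit of a point. -/
def forwardOrbit {X : Type*} [TopologicalSpace X] (T : X → X) (x : X) : Set X :=
  ⋃ n : ℕ, (img T)^[n] ({x} : Set X)

/-- The (two-sided) orbit of a point. -/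
def orbit {X : Type*} [TopologicalSpace X] (T : X → X) (x : X) : Set X :=
  ⋃ k : ℤ, iterImg T k ({x} : Set X)

/-- `x` is periodic: `T^n(x) = x` for some `n ≥ 1`, all iterates being defined. -/
def IsPeriodicOrbit {X : Type*} [TopologicalSpace X] (T : X → X) (x : X) : Prop :=
  ∃ n : ℕ, 1 ≤ n ∧ x ∈ (img T)^[n] ({x} : Set X)

/-- An eligible map: it admits an admissible set and preserves the measure `μ`
away from singularities. -/
def Eligible {X : Type*} [TopologicalSpace X] [MeasurableSpace X] (μ : Measure X)
    (T : X → X) : Prop :=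
  (∃ S, Admissible T S) ∧
    ∀ A : Set X, MeasurableSet A → A ⊆ (Sing T)ᶜ → μ (T '' A) = μ A

/-- A finite union of bounded open intervals with pairwise disjoint closures. -/
def IsFiniteUnionOfIntervals (S : Set ℝ) : Prop :=
  ∃ (n : ℕ) (a b : Fin n → ℝ), (∀ i, a i < b i) ∧
    S = ⋃ i, Ioo (a i) (b i) ∧
    Pairwise fun i j => Disjoint (Icc (a i) (b i)) (Icc (a j) (b j))

/-- `T` is a translation on each connected component of `X \ Sing T`. -/
def IsTranslationOnComponents (X : Set ℝ) (T : ↥X → ↥X) : Prop :=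
  ∀ x y : ↥X, x ∉ Sing T → y ∈ connectedComponentIn ((Sing T)ᶜ) x →
    (T y : ℝ) - (y : ℝ) = (T x : ℝ) - (x : ℝ)

/-- An interval exchange transformation. -/
def IsIET (X : Set ℝ) (T : ↥X → ↥X) : Prop :=
  IsFiniteUnionOfIntervals X ∧
    Eligible (MeasureTheory.Measure.comap (Subtype.val : ↥X → ℝ) volume) T ∧
    (Sing T).Finite ∧ IsTranslationOnComponents X T

/-- A nontrivial union of connected components of `X` is invariant. -/
def IETReducible (X : Set ℝ) (T : ↥X → ↥X) : Prop :=
  ∃ U : Set ↥X, U.Nonempty ∧ U ≠ univ ∧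
    (∀ x ∈ U, connectedComponent x ⊆ U) ∧ img T U ⊆ U


theorem iterate_mem_iterate_img {X : Type*} [TopologicalSpace X] (T : X → X) (x : X) (n : ℕ)
    (h : ∀ i < n, T^[i] x ∉ Sing T) : T^[n] x ∈ (img T)^[n] ({x} : Set X) := by
  induction n with
  | zero => simp
  | succ n ih =>
    rw [Function.iterate_succ_apply', Function.iterate_succ_apply']
    exact mem_image_of_mem _ ⟨ih fun i hi => h i (by omega), h n (by omega)⟩

theorem eq_iterate_of_mem_iterate_img {X : Type*} [TopologicalSpace X] (T : X → X) (x : X)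
    (n : ℕ) : ∀ y ∈ (img T)^[n] ({x} : Set X), y = T^[n] x ∧ ∀ i < n, T^[i] x ∉ Sing T := by
  induction n with
  | zero => simp
  | succ n ih =>
    intro y hy
    rw [Function.iterate_succ_apply'] at hy
    obtain ⟨z, ⟨hz, hzS⟩, rfl⟩ := hy
    obtain ⟨rfl, h⟩ := ih z hz
    refine ⟨(Function.iterate_succ_apply' T n x).symm, fun i hi => ?_⟩
    rcases Nat.lt_succ_iff_lt_or_eq.1 hi with hi | rfl
    · exact h i hi
    · exact hzS

theorem iterate_notMem_sing_of_infinite {X : Type*} [TopologicalSpace X] (T : X → X) (x : X)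
    (hinf : (forwardOrbit T x).Infinite) (n : ℕ) : T^[n] x ∉ Sing T := by
  intro hn
  refine hinf (((finite_Iic n).image fun k => T^[k] x).subset fun y hy => ?_)
  obtain ⟨k, hk⟩ := mem_iUnion.1 hy
  obtain ⟨rfl, h⟩ := eq_iterate_of_mem_iterate_img T x k y hk
  exact ⟨k, not_lt.1 fun hlt => h n hlt hn, rfl⟩

/-- Iterates of a map injective off `S` can be cancelled along orbits avoiding `S`. -/
theorem eq_iterate_sub_of_iterate_eq {X : Type*} {T : X → X} {S : Set X} (hT : InjOn T Sᶜ)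
    (n : ℕ) : ∀ (m : ℕ) (p q : X), n ≤ m → (∀ i < n, T^[i] p ∉ S) → (∀ i < m, T^[i] q ∉ S) →
      T^[n] p = T^[m] q → p = T^[m - n] q := by
  induction n with
  | zero => intro m p q _ _ _ h; simpa using h
  | succ n ih =>
    intro m p q hnm hp hq h
    obtain ⟨m, rfl⟩ : ∃ k, m = k + 1 := ⟨m - 1, by omega⟩
    rw [Function.iterate_succ_apply', Function.iterate_succ_apply'] at h
    have := ih m p q (by omega) (fun i hi => hp i (by omega)) (fun i hi => hq i (by omega))
      (hT (hp n (by omega)) (hq m (by omega)) h)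
    rwa [Nat.succ_sub_succ]

theorem IsFiniteUnionOfIntervals.isOpen {X : Set ℝ} (h : IsFiniteUnionOfIntervals X) :
    IsOpen X := by
  obtain ⟨n, a, b, -, rfl, -⟩ := h
  exact isOpen_iUnion fun _ => isOpen_Ioo

theorem IsFiniteUnionOfIntervals.isBounded {X : Set ℝ} (h : IsFiniteUnionOfIntervals X) :
    Bornology.IsBounded X := by
  obtain ⟨n, a, b, -, rfl, -⟩ := h
  exact (Bornology.isBounded_iUnion).2 fun _ => Metric.isBounded_Ioo _ _

/-- `T` is a translation along any path of constant velocity avoiding the singularities. -/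
theorem IsTranslationOnComponents.apply_path {X : Set ℝ} {T : ↥X → ↥X}
    (hT : IsTranslationOnComponents X T) {σ c : ℝ} {z : ↥X} (f : ℝ → ↥X)
    (hf : ∀ t ∈ Ico 0 c, (f t : ℝ) = z + σ * t) (hS : ∀ t ∈ Ico 0 c, f t ∉ Sing T)
    {t : ℝ} (ht : t ∈ Ico 0 c) : (T (f t) : ℝ) = T z + σ * t := by
  have h0 : (0 : ℝ) ∈ Ico 0 c := ⟨le_rfl, ht.1.trans_lt ht.2⟩
  have hz : f 0 = z := Subtype.ext (by simpa using hf 0 h0)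
  have hcont : ContinuousOn f (Ico 0 c) := by
    rw [Topology.IsInducing.subtypeVal.continuousOn_iff]
    exact ContinuousOn.congr (f := fun t => (z : ℝ) + σ * t) (by fun_prop) hf
  have hsub : f '' Ico 0 c ⊆ connectedComponentIn (Sing T)ᶜ z :=
    (isPreconnected_Ico.image f hcont).subset_connectedComponentIn ⟨0, h0, hz⟩
      (by rintro _ ⟨s, hs, rfl⟩; exact hS s hs)
  have := hT z (f t) (hz ▸ hS 0 h0) (hsub ⟨t, ht, rfl⟩)
  rw [hf t ht] at this
  linarith

/-- The point `x + s` of `X`, or `x` if `x + s ∉ X`. -/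
noncomputable def shift {X : Set ℝ} (x : ↥X) (s : ℝ) : ↥X :=
  open Classical in if h : (x : ℝ) + s ∈ X then ⟨x + s, h⟩ else x

theorem coe_shift {X : Set ℝ} {x : ↥X} {s : ℝ} (h : (x : ℝ) + s ∈ X) :
    (shift x s : ℝ) = x + s := by
  simp [shift, h]

theorem shift_zero {X : Set ℝ} (x : ↥X) : shift x 0 = x := by
  simp [shift]

theorem eventually_coe_shift {X : Set ℝ} (hX : IsOpen X) (x : ↥X) :
    ∀ᶠ s in 𝓝 (0 : ℝ), (shift x s : ℝ) = x + s := by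
  have : Filter.Tendsto (fun s : ℝ => (x : ℝ) + s) (𝓝 0) (𝓝 x) := by
    simpa using (continuous_const_add (x : ℝ)).tendsto 0
  filter_upwards [this.eventually (hX.mem_nhds x.2)] with s hs using coe_shift hs

theorem tendsto_shift {X : Set ℝ} (hX : IsOpen X) (x : ↥X) :
    Filter.Tendsto (fun s => shift x s) (𝓝 0) (𝓝 x) := by
  rw [tendsto_subtype_rng]
  refine Filter.Tendsto.congr' (f₁ := fun s : ℝ => (x : ℝ) + s) ?_ ?_
  · filter_upwards [eventually_coe_shift hX x] with s hs using hs.symm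
  · simpa using (continuous_const_add (x : ℝ)).tendsto 0

theorem eventually_apply_shift {X : Set ℝ} {T : ↥X → ↥X} (hX : IsOpen X)
    (hT : IsTranslationOnComponents X T) (hfin : (Sing T).Finite) {p : ↥X} (hp : p ∉ Sing T) :
    ∀ᶠ s in 𝓝[>] (0 : ℝ), (T (shift p s) : ℝ) = T p + s := by
  have h : ∀ᶠ s in 𝓝 (0 : ℝ), shift p s ∉ Sing T ∧ (shift p s : ℝ) = p + s :=
    ((tendsto_shift hX p).eventually (hfin.isClosed.isOpen_compl.mem_nhds hp)).and
      (eventually_coe_shift hX p)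
  obtain ⟨c, hc, h⟩ := Metric.eventually_nhds_iff.1 h
  have h' : ∀ s ∈ Ico 0 c, shift p s ∉ Sing T ∧ (shift p s : ℝ) = p + s := fun s hs =>
    h (by rw [Real.dist_eq, sub_zero, abs_of_nonneg hs.1]; exact hs.2)
  filter_upwards [Ioo_mem_nhdsGT hc] with s hs
  simpa using hT.apply_path (σ := 1) (shift p) (fun t ht => by simpa using (h' t ht).2)
    (fun t ht => (h' t ht).1) ⟨hs.1.le, hs.2⟩

theorem eventually_shift_notMem {X : Set ℝ} (hX : IsOpen X) {S : Set ↥X} (hS : IsClosed S)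
    (hd : DiscreteTopology ↥S) (p : ↥X) : ∀ᶠ s in 𝓝[>] (0 : ℝ), shift p s ∉ S := by
  have hp : ∀ᶠ y in 𝓝[≠] p, y ∉ S := by
    have := isClosed_and_discrete_iff.1 ⟨hS, isDiscrete_iff_discreteTopology.2 hd⟩ p
    rwa [Filter.disjoint_principal_right] at this
  have ht : Filter.Tendsto (fun s => shift p s) (𝓝[>] 0) (𝓝[≠] p) := by
    refine tendsto_nhdsWithin_iff.2 ⟨(tendsto_shift hX p).mono_left nhdsWithin_le_nhds, ?_⟩
    filter_upwards [(eventually_coe_shift hX p).filter_mono nhdsWithin_le_nhds,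
      self_mem_nhdsWithin] with s hs (hs0 : 0 < s) heq
    rw [heq] at hs
    linarith
  exact ht.eventually hp

theorem IsIET.injOn {X : Set ℝ} {T : ↥X → ↥X} (h : IsIET X T) : InjOn T (Sing T)ᶜ := by
  obtain ⟨hX, ⟨⟨S, hS, hd, S', -, -, g, hg⟩, -⟩, hfin, hT⟩ := h
  have hinj : InjOn T Sᶜ := fun u hu v hv huv => by
    have : g ⟨u, hu⟩ = g ⟨v, hv⟩ := Subtype.ext (by rw [hg, hg]; exact huv)
    simpa using g.injective this
  intro p hp q hq hpq
  obtain ⟨s, ⟨⟨h1, h2⟩, h3, h4⟩, h5, h6⟩ :=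
    (((eventually_apply_shift hX.isOpen hT hfin hp).and
      (eventually_apply_shift hX.isOpen hT hfin hq)).and
      ((eventually_shift_notMem hX.isOpen hS hd p).and
      (eventually_shift_notMem hX.isOpen hS hd q))).and
      (((eventually_coe_shift hX.isOpen p).filter_mono nhdsWithin_le_nhds).and
      ((eventually_coe_shift hX.isOpen q).filter_mono nhdsWithin_le_nhds)) |>.exists
  have := hinj h3 h4 (Subtype.ext (by rw [h1, h2, hpq]))
  rw [this, h6] at h5
  exact Subtype.ext (by linarith)

/-- The points of `K` whose orbit reaches a finite set `F` before returning to `K` are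
finitely many. -/
theorem finite_setOf_reaches_before_return {X : Type*} {T : X → X} {S F : Set X}
    (hT : InjOn T Sᶜ) (hF : F.Finite) (K : Set X) :
    {p ∈ K | ∃ n, T^[n] p ∈ F ∧ (∀ i < n, T^[i] p ∉ S) ∧
      ∀ i, 1 ≤ i → i ≤ n → T^[i] p ∉ K}.Finite := by
  have key : ∀ p ∈ K, ∀ q, ∀ n m : ℕ, n ≤ m → (∀ i < n, T^[i] p ∉ S) →
      (∀ i < m, T^[i] q ∉ S) → (∀ i, 1 ≤ i → i ≤ m → T^[i] q ∉ K) →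
      T^[n] p = T^[m] q → p = q := by
    intro p hp q n m hnm hpS hqS hq h
    have h' := eq_iterate_sub_of_iterate_eq hT n m p q hnm hpS hqS h
    rcases Nat.eq_zero_or_pos (m - n) with h0 | h0
    · simpa [h0] using h'
    · exact absurd (h' ▸ hp) (hq (m - n) h0 (Nat.sub_le _ _))
  set D := {p ∈ K | ∃ n, T^[n] p ∈ F ∧ (∀ i < n, T^[i] p ∉ S) ∧
      ∀ i, 1 ≤ i → i ≤ n → T^[i] p ∉ K} with hD
  choose! N hN using fun p (hp : p ∈ D) => hp.2
  refine Finite.of_finite_image (f := fun p => T^[N p] p) (hF.subset ?_) ?_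
  · rintro _ ⟨p, hp, rfl⟩
    exact (hN p hp).1
  · intro p hp q hq h
    obtain ⟨-, hpS, hpK⟩ := hN p hp
    obtain ⟨-, hqS, hqK⟩ := hN q hq
    rcases le_total (N p) (N q) with hle | hle
    · exact key p hp.1 q _ _ hle hpS hqS hqK h
    · exact (key q hq.1 p _ _ hle hqS hpS hpK h.symm).symm

theorem exists_lt_abs_sub_lt_of_isBounded {u : ℕ → ℝ} (hu : Bornology.IsBounded (range u))
    {ε : ℝ} (hε : 0 < ε) : ∃ n m, n < m ∧ |u n - u m| < ε := by
  obtain ⟨a, -, φ, hφ, ha⟩ := tendsto_subseq_of_bounded hu fun n => mem_range_self n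
  obtain ⟨N, hN⟩ := Metric.cauchySeq_iff.1 ha.cauchySeq ε hε
  exact ⟨φ N, φ (N + 1), hφ N.lt_succ_self, hN N le_rfl (N + 1) (Nat.le_succ N)⟩

theorem IsIET.exists_iterate_mem_one_sided {X : Set ℝ} {T : ↥X → ↥X} (h : IsIET X T) (x : ↥X)
    (hS : ∀ n, T^[n] x ∉ Sing T) (hnp : ∀ n, 1 ≤ n → T^[n] x ≠ x) {σ d : ℝ} (hσ : σ * σ = 1)
    (hd : 0 < d) (hdX : ∀ t ∈ Ico 0 d, (x : ℝ) + σ * t ∈ X) :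
    ∃ n, 1 ≤ n ∧ ∃ t ∈ Ioo 0 d, (T^[n] x : ℝ) = x + σ * t := by
  by_contra! hcon
  have hinj := h.injOn
  obtain ⟨hX, -, hfin, hT⟩ := h
  have hσ0 : σ ≠ 0 := by rintro rfl; simp at hσ
  set K : Set ↥X := {y | ∃ t ∈ Ioo 0 d, (y : ℝ) = x + σ * t}
  have hxK : x ∉ K := by
    rintro ⟨t, ht, hxt⟩
    have : σ * t = 0 := by linarith
    rcases mul_eq_zero.1 this with h0 | h0
    · exact hσ0 h0
    · exact ht.1.ne' h0
  have hDfin := finite_setOf_reaches_before_return hinj (hfin.insert x) K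
  set D := {p ∈ K | ∃ n, T^[n] p ∈ insert x (Sing T) ∧ (∀ i < n, T^[i] p ∉ Sing T) ∧
      ∀ i, 1 ≤ i → i ≤ n → T^[i] p ∉ K}
  have hxD : x ∉ D := fun hx => hxK hx.1
  set e : ℝ → ↥X := fun t => shift x (σ * t)
  have he : ∀ t ∈ Ico 0 d, (e t : ℝ) = x + σ * t := fun t ht => coe_shift (hdX t ht)
  have he0 : e 0 = x := by simp [e, shift_zero]
  have hev : ∀ᶠ t in 𝓝 (0 : ℝ), e t ∉ D := by
    have h1 : Filter.Tendsto (fun t : ℝ => σ * t) (𝓝 0) (𝓝 0) := by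
      simpa using (continuous_const_mul σ).tendsto 0
    exact ((tendsto_shift hX.isOpen x).comp h1).eventually
      (hDfin.isClosed.isOpen_compl.mem_nhds hxD)
  obtain ⟨c₀, hc₀, hev⟩ := Metric.eventually_nhds_iff.1 hev
  obtain ⟨c, hc, hcd, hcc⟩ : ∃ c, 0 < c ∧ c ≤ d ∧ c ≤ c₀ :=
    ⟨min d c₀, lt_min hd hc₀, min_le_left _ _, min_le_right _ _⟩
  have heD : ∀ t ∈ Ioo 0 c, e t ∉ D := fun t ht =>
    hev (by rw [Real.dist_eq, sub_zero, abs_of_pos ht.1]; exact ht.2.trans_le hcc)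
  have heK : ∀ t ∈ Ioo 0 c, e t ∈ K := fun t ht =>
    ⟨t, ⟨ht.1, ht.2.trans_le hcd⟩, he t ⟨ht.1.le, ht.2.trans_le hcd⟩⟩
  have main : ∀ n, (∀ t ∈ Ico 0 c, (T^[n] (e t) : ℝ) = T^[n] x + σ * t) ∧
      (∀ i < n, ∀ t ∈ Ico 0 c, T^[i] (e t) ∉ Sing T) ∧
      (∀ i, 1 ≤ i → i ≤ n → ∀ t ∈ Ioo 0 c, T^[i] (e t) ∉ K) := by
    intro n
    induction n with
    | zero =>
      exact ⟨fun t ht => he t ⟨ht.1, ht.2.trans_le hcd⟩, fun i hi => absurd hi (by omega),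
        fun i h1 h2 => absurd h1 (by omega)⟩
    | succ n ih =>
      obtain ⟨ih1, ih2, ih3⟩ := ih
      have hn : ∀ t ∈ Ico 0 c, T^[n] (e t) ∉ Sing T := by
        intro t ht hmem
        rcases ht.1.eq_or_lt with rfl | ht0
        · exact hS n (he0 ▸ hmem)
        · exact heD t ⟨ht0, ht.2⟩ ⟨heK t ⟨ht0, ht.2⟩, n, Or.inr hmem,
            fun i hi => ih2 i hi t ht, fun i h1 h2 => ih3 i h1 h2 t ⟨ht0, ht.2⟩⟩
      have hS' : ∀ i < n + 1, ∀ t ∈ Ico 0 c, T^[i] (e t) ∉ Sing T := by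
        intro i hi
        rcases Nat.lt_succ_iff_lt_or_eq.1 hi with hi | rfl
        · exact ih2 i hi
        · exact hn
      have htr : ∀ t ∈ Ico 0 c, (T^[n + 1] (e t) : ℝ) = T^[n + 1] x + σ * t := by
        intro t ht
        rw [Function.iterate_succ_apply', Function.iterate_succ_apply']
        exact hT.apply_path (fun t => T^[n] (e t)) ih1 hn ht
      refine ⟨htr, hS', fun i h1 h2 => ?_⟩
      rcases h2.lt_or_eq with h2 | rfl
      · exact ih3 i h1 (by omega)
      rintro t ht ⟨s, hs, hts⟩
      rw [htr t ⟨ht.1.le, ht.2⟩] at hts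
      have hx : (T^[n + 1] x : ℝ) = x + σ * (s - t) := by linarith
      rcases lt_trichotomy s t with hst | rfl | hst
      · have hu : t - s ∈ Ioo 0 c := ⟨by linarith, by linarith [hs.1, ht.2]⟩
        have hret : T^[n + 1] (e (t - s)) = x :=
          Subtype.ext (by rw [htr _ ⟨hu.1.le, hu.2⟩, hx]; ring)
        refine heD _ hu ⟨heK _ hu, n + 1, Or.inl hret, fun i hi => hS' i hi _ ⟨hu.1.le, hu.2⟩, ?_⟩
        intro i h1 h2
        rcases h2.lt_or_eq with h2 | rfl
        · exact ih3 i h1 (by omega) _ hu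
        · rwa [hret]
      · exact hnp (n + 1) h1 (Subtype.ext (by simpa using hx))
      · exact hcon (n + 1) h1 (s - t) ⟨by linarith, by linarith [hs.2, ht.1]⟩ hx
  have hbdd : Bornology.IsBounded (range fun n => σ * (T^[n] x : ℝ)) := by
    have := hX.isBounded.smul₀ σ
    refine this.subset ?_
    rintro _ ⟨n, rfl⟩
    exact smul_mem_smul_set (T^[n] x).2
  obtain ⟨n, m, hnm, hlt⟩ := exists_lt_abs_sub_lt_of_isBounded hbdd (half_pos hc)
  obtain ⟨hlt1, hlt2⟩ := abs_lt.1 hlt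
  have ht : c / 2 + σ * (T^[m] x : ℝ) - σ * (T^[n] x : ℝ) ∈ Ioo 0 c :=
    ⟨by linarith, by linarith⟩
  have hs : c / 2 ∈ Ioo 0 c := ⟨by linarith, by linarith⟩
  have heq : T^[n] (e (c / 2 + σ * (T^[m] x : ℝ) - σ * (T^[n] x : ℝ))) = T^[m] (e (c / 2)) := by
    refine Subtype.ext ?_
    rw [(main n).1 _ ⟨ht.1.le, ht.2⟩, (main m).1 _ ⟨hs.1.le, hs.2⟩]
    linear_combination ((T^[m] x : ℝ) - (T^[n] x : ℝ)) * hσ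
  have hret := eq_iterate_sub_of_iterate_eq hinj n m _ _ hnm.le
    (fun i hi => (main n).2.1 i hi _ ⟨ht.1.le, ht.2⟩)
    (fun i hi => (main m).2.1 i hi _ ⟨hs.1.le, hs.2⟩) heq
  exact (main (m - n)).2.2 (m - n) (by omega) le_rfl _ hs (hret ▸ heK _ ht)

/-- for an IET with no connections, a point with infinite
non-periodic forward orbit returns to every open interval having it as an
endpoint. -/
theorem iet_forward_orbit_returns (X : Set ℝ) (T : ↥X → ↥X) (hIET : IsIET X T)
    (hnoconn : ∀ y : ↥X, ¬ ((orbit T y).Finite ∧ ¬ IsPeriodicOrbit T y))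
    (x : ↥X) (hinf : (forwardOrbit T x).Infinite) (hnp : ¬ IsPeriodicOrbit T x)
    (I : Set ℝ)
    (hI : (∃ a : ℝ, a < (x : ℝ) ∧ I = Ioo a (x : ℝ)) ∨
          (∃ b : ℝ, (x : ℝ) < b ∧ I = Ioo (x : ℝ) b)) :
    ∃ n : ℕ, 1 ≤ n ∧ ∃ y ∈ (img T)^[n] ({x} : Set ↥X), (y : ℝ) ∈ I := by
  have hS := iterate_notMem_sing_of_infinite T x hinf
  have hnp' : ∀ n, 1 ≤ n → T^[n] x ≠ x := fun n hn hx =>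
    hnp ⟨n, hn, by simpa only [hx] using iterate_mem_iterate_img T x n fun i _ => hS i⟩
  obtain ⟨ε, hε, hball⟩ := Metric.isOpen_iff.1 hIET.1.isOpen x x.2
  have side : ∀ σ d : ℝ, (σ = 1 ∨ σ = -1) → 0 < d →
      (∀ t ∈ Ioo 0 d, (x : ℝ) + σ * t ∈ I) →
      ∃ n : ℕ, 1 ≤ n ∧ ∃ y ∈ (img T)^[n] ({x} : Set ↥X), (y : ℝ) ∈ I := by
    intro σ d hσ hd hdI
    obtain ⟨n, hn, t, ht, hnt⟩ := hIET.exists_iterate_mem_one_sided x hS hnp' (σ := σ)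
      (d := min d ε) (by rcases hσ with rfl | rfl <;> norm_num) (lt_min hd hε) fun t ht =>
        hball (by
          have := ht.2.trans_le (min_le_right d ε)
          rcases hσ with rfl | rfl <;> simpa [Real.dist_eq, abs_of_nonneg ht.1] using this)
    exact ⟨n, hn, _, iterate_mem_iterate_img T x n fun i _ => hS i,
      hnt ▸ hdI t ⟨ht.1, ht.2.trans_le (min_le_left _ _)⟩⟩
  rcases hI with ⟨a, ha, rfl⟩ | ⟨b, hb, rfl⟩
  · exact side (-1) (x - a) (Or.inr rfl) (by linarith) fun t ht =>
      ⟨by linarith [ht.2], by linarith [ht.1]⟩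
  · exact side 1 (b - x) (Or.inl rfl) (by linarith) fun t ht =>
      ⟨by linarith [ht.1], by linarith [ht.2]⟩
end

section
/- Let T be an interval exchange transformation and I ⊆ X a nonempty open interval. Then the set of points of I whose forward trajectory reaches a singularity before returning to I is finite; that is, the set {y ∈ I : there exists n ≥ 0 such that T^i(y) is defined for all 0 ≤ i ≤ n, T^i(y) ∉ I for all 1 ≤ i ≤ n, and T^n(y) ∈ Sing(T)} is a finite set. -/
open Set Topology MeasureTheory

/-- `T` is open at every point outside an admissible set. -/
theorem Admissible.nhds_le_map {X : Type*} [TopologicalSpace X] {T : X → X} {S : Set X}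
    (hS : Admissible T S) {x : X} (hx : x ∉ S) : 𝓝 (T x) ≤ Filter.map T (𝓝 x) := by
  obtain ⟨hc, -, S', hc', -, h, hT⟩ := hS
  have e₁ : IsOpenEmbedding (Subtype.val : ↥(Sᶜ) → X) := hc.isOpen_compl.isOpenEmbedding_subtypeVal
  have e₂ : IsOpenEmbedding (Subtype.val : ↥(S'ᶜ) → X) :=
    hc'.isOpen_compl.isOpenEmbedding_subtypeVal
  have h₁ := e₁.map_nhds_eq ⟨x, hx⟩
  have h₂ := (e₂.comp h.isOpenEmbedding).map_nhds_eq ⟨x, hx⟩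
  have hcomp : (Subtype.val ∘ h : ↥(Sᶜ) → X) = T ∘ Subtype.val := funext hT
  rw [hcomp, ← Filter.map_map, h₁] at h₂
  exact h₂.ge

theorem Admissible.punctured_nhds_le_map {X : Type*} [TopologicalSpace X] {T : X → X} {S : Set X}
    (hS : Admissible T S) {x : X} (hx : x ∉ S) : 𝓝[≠] (T x) ≤ Filter.map T (𝓝[≠] x) := by
  intro A hA
  rw [Filter.mem_map, mem_nhdsWithin_iff_eventually] at hA
  rw [mem_nhdsWithin_iff_eventually]
  refine hS.nhds_le_map hx ?_
  rw [Filter.mem_map]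
  filter_upwards [hA] with y hy hne
  exact hy fun h => hne (congrArg T h)

theorem Admissible.compl_mem_punctured_nhds {X : Type*} [TopologicalSpace X] {T : X → X}
    {S : Set X} (hS : Admissible T S) (x : X) : Sᶜ ∈ 𝓝[≠] x := by
  have h := isClosed_and_discrete_iff.1 ⟨hS.1, isDiscrete_iff_discreteTopology.2 hS.2.1⟩ x
  exact Filter.disjoint_principal_right.1 h

/-- In a Hausdorff space without isolated points, `T` is injective outside its singularities. -/
theorem injOn_compl_sing {X : Type*} [TopologicalSpace X] [T2Space X]
    [∀ x : X, (𝓝[≠] x).NeBot] (T : X → X) : InjOn T (Sing T)ᶜ := by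
  intro x hx y hy hxy
  simp only [Sing, mem_compl_iff, mem_sInter, mem_ofPred_eq, not_forall] at hx hy
  obtain ⟨S₁, hS₁, hx⟩ := hx
  obtain ⟨S₂, hS₂, hy⟩ := hy
  by_contra hne
  obtain ⟨U, V, hU, hV, hxU, hyV, hUV⟩ := t2_separation hne
  have hA : T '' (U ∩ S₁ᶜ) ∈ 𝓝[≠] (T x) :=
    hS₁.punctured_nhds_le_map hx <| Filter.image_mem_map <| Filter.inter_mem
      (mem_nhdsWithin_of_mem_nhds (hU.mem_nhds hxU)) (hS₁.compl_mem_punctured_nhds x)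
  have hB : T '' (V ∩ S₁ᶜ) ∈ 𝓝[≠] (T x) := by
    rw [hxy]
    exact hS₂.punctured_nhds_le_map hy <| Filter.image_mem_map <| Filter.inter_mem
      (mem_nhdsWithin_of_mem_nhds (hV.mem_nhds hyV)) (hS₁.compl_mem_punctured_nhds y)
  obtain ⟨p, ⟨u, ⟨huU, hu⟩, rfl⟩, v, ⟨hvV, hv⟩, huv⟩ :=
    Filter.nonempty_of_mem (Filter.inter_mem hA hB)
  obtain ⟨-, -, S', -, -, h, hT⟩ := hS₁
  have : (⟨v, hv⟩ : ↥(S₁ᶜ)) = ⟨u, hu⟩ := h.injective <| Subtype.ext <| by rw [hT, hT, huv]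
  obtain rfl : v = u := congrArg Subtype.val this
  exact disjoint_left.1 hUV huU hvV

theorem mem_img_iterate_succ {X : Type*} [TopologicalSpace X] {T : X → X} {n : ℕ} {A : Set X}
    {z : X} : z ∈ (img T)^[n + 1] A ↔ ∃ w ∈ (img T)^[n] A, w ∉ Sing T ∧ T w = z := by
  rw [Function.iterate_succ_apply']
  simp only [img, mem_image, mem_sdiff, and_assoc]

/-- If two forward orbits reach the same point, the one that takes longer passes through the
starting point of the other. -/
theorem mem_img_iterate_of_common {X : Type*} [TopologicalSpace X] {T : X → X}
    (hT : InjOn T (Sing T)ᶜ) {x y z : X} {n k : ℕ} (hx : z ∈ (img T)^[n] ({x} : Set X))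
    (hy : z ∈ (img T)^[k + n] ({y} : Set X)) : x ∈ (img T)^[k] ({y} : Set X) := by
  induction n generalizing z with
  | zero =>
    obtain rfl : z = x := hx
    exact hy
  | succ n ih =>
    obtain ⟨w, hw, hws, rfl⟩ := mem_img_iterate_succ.1 hx
    obtain ⟨v, hv, hvs, hvw⟩ := mem_img_iterate_succ.1 hy
    obtain rfl : v = w := hT hvs hws hvw
    exact ih hw hv

theorem IsFiniteUnionOfIntervals.isOpen_s10 {S : Set ℝ} (hS : IsFiniteUnionOfIntervals S) :
    IsOpen S := by
  obtain ⟨n, a, b, -, rfl, -⟩ := hS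
  exact isOpen_iUnion fun _ => isOpen_Ioo

theorem IsOpen.neBot_punctured_nhds_subtype {Y : Type*} [TopologicalSpace Y]
    [∀ y : Y, (𝓝[≠] y).NeBot] {X : Set Y} (hX : IsOpen X) (x : ↥X) : (𝓝[≠] x).NeBot := by
  rw [← mem_closure_iff_nhdsWithin_neBot, mem_closure_iff]
  intro o ho hxo
  have h := hX.isOpenMap_subtype_val o ho
  obtain ⟨y, ⟨⟨z, hz, rfl⟩, hy⟩⟩ := mem_closure_iff.1
    (mem_closure_iff_nhdsWithin_neBot.2 (inferInstance : (𝓝[≠] (x : Y)).NeBot)) _ h ⟨x, hxo, rfl⟩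
  exact ⟨z, hz, fun e => hy (congrArg Subtype.val e)⟩

/-- for an IET and a nonempty open interval `I ⊆ X`, only
finitely many points of `I` reach a singularity before returning to `I`. -/
theorem iet_finitely_many_singular_returns (X : Set ℝ) (T : ↥X → ↥X)
    (hIET : IsIET X T) (I : Set ↥X) (hne : I.Nonempty)
    (hint : ∃ a b : ℝ, (Subtype.val : ↥X → ℝ) '' I = Ioo a b) :
    Set.Finite {y : ↥X | y ∈ I ∧ ∃ n : ℕ, ∃ z ∈ (img T)^[n] ({y} : Set ↥X),
      z ∈ Sing T ∧
        ∀ i : ℕ, 1 ≤ i → i ≤ n → ∀ w ∈ (img T)^[i] ({y} : Set ↥X), w ∉ I} := by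
  have : ∀ x : ↥X, (𝓝[≠] x).NeBot := hIET.1.isOpen_s10.neBot_punctured_nhds_subtype
  have hT := injOn_compl_sing T
  have key : ∀ {x y z : ↥X} {n m : ℕ}, n ≤ m → x ∈ I → z ∈ (img T)^[n] {x} →
      z ∈ (img T)^[m] {y} → (∀ i : ℕ, 1 ≤ i → i ≤ m → ∀ w ∈ (img T)^[i] {y}, w ∉ I) → x = y := by
    intro x y z n m hnm hxI hx hy hr
    obtain ⟨k, rfl⟩ := Nat.exists_eq_add_of_le' hnm
    have h := mem_img_iterate_of_common hT hx hy
    rcases Nat.eq_zero_or_pos k with rfl | hk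
    · exact h
    · exact absurd hxI (hr k hk (Nat.le_add_right k n) x h)
  choose! n z hz hs hr using fun (y : ↥X) (hy : y ∈ {y : ↥X | y ∈ I ∧ ∃ n : ℕ,
    ∃ z ∈ (img T)^[n] ({y} : Set ↥X), z ∈ Sing T ∧
      ∀ i : ℕ, 1 ≤ i → i ≤ n → ∀ w ∈ (img T)^[i] ({y} : Set ↥X), w ∉ I}) => hy.2
  refine Set.Finite.of_finite_image (f := z) (hIET.2.2.1.subset ?_) ?_
  · rintro _ ⟨y, hy, rfl⟩
    exact hs y hy
  · intro x hx y hy hxy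
    have hzx := hz x hx
    have hzy := hz y hy
    rcases le_total (n x) (n y) with h | h
    · exact key h hx.1 hzx (hxy ▸ hzy) (hr y hy)
    · exact (key h hy.1 hzy (hxy ▸ hzx) (hr x hx)).symm
end
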